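/- Let n be an odd positive integer and let ζ ∈ ℂ be a primitive n-th root of unity. Then Σ_{k=0}^{(n-1)/2} (-1)^k ζ^{k} (ζ;ζ²)_k / (-ζ;ζ)_k = 2 ζ^{-1} · Σ_{k=0}^{(n-1)/2} (-1)^k ζ^{2(k+1)²} (ζ²;ζ⁴)_k / (-ζ²;ζ²)_{2k+1}. That is, the sixth order mock theta functions λ and ψ satisfy λ(ζ) = 2 ζ^{-1} ψ(ζ²). -/

import Mathlib

/-- The q-Pochhammer symbol `(a;q)_k = ∏_{j=0}^{k-1} (1 - a q^j)`. -/
noncomputable def qPoch (a q : ℂ) (k : ℕ) : ℂ :=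
  ∏ j ∈ Finset.range k, (1 - a * q ^ j)

lemma qPoch_zero (a q : ℂ) : qPoch a q 0 = 1 := by simp [qPoch]

lemma qPoch_succ (a q : ℂ) (k : ℕ) :
    qPoch a q (k + 1) = qPoch a q k * (1 - a * q ^ k) :=
  Finset.prod_range_succ _ _

lemma qPoch_self_succ (q : ℂ) (k : ℕ) :
    qPoch q q (k + 1) = qPoch q q k * (1 - q ^ (k + 1)) := by
  rw [qPoch_succ, pow_succ']

lemma qPoch_self_ne_zero {q : ℂ} {k : ℕ} (h : ∀ i, 0 < i → i ≤ k → q ^ i ≠ 1) :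
    qPoch q q k ≠ 0 := by
  refine Finset.prod_ne_zero_iff.2 fun i hi => ?_
  have := h (i + 1) i.succ_pos (Finset.mem_range.1 hi)
  rw [← pow_succ']
  exact sub_ne_zero.2 this.symm

/-- Gauss's evaluation of the alternating sum of the `q`-binomial coefficients `[2k, j]`, folded at
the middle coefficient and divided by `(q;q)_{2k}`. -/
lemma sum_alternating_inv_qPoch (q : ℂ) (k : ℕ) (h : ∀ i, 0 < i → i ≤ 2 * k → q ^ i ≠ 1) :
    ∑ s ∈ Finset.range (k + 1), (if s = 0 then 1 else 2) * (-1 : ℂ) ^ (k + s) /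
        (qPoch q q (k - s) * qPoch q q (k + s)) =
      (qPoch (q ^ 2) (q ^ 2) k)⁻¹ := by
  induction k with
  | zero => simp [qPoch_zero]
  | succ k ih =>
    have hne : ∀ i, i ≤ 2 * k + 2 → qPoch q q i ≠ 0 := fun i hi =>
      qPoch_self_ne_zero fun j hj hji => h j hj (by omega)
    have hs : ∀ i, 0 < i → i ≤ 2 * k + 2 → 1 - q ^ i ≠ 0 := fun i h0 hi =>
      sub_ne_zero.2 (h i h0 (by omega)).symm
    have partialSum : ∀ J ≤ k,
        ∑ s ∈ Finset.range (J + 1), (if s = 0 then 1 else 2) * (-1 : ℂ) ^ (k + 1 + s) /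
            (qPoch q q (k + 1 - s) * qPoch q q (k + 1 + s)) =
          (∑ s ∈ Finset.range (J + 1), (if s = 0 then 1 else 2) * (-1 : ℂ) ^ (k + s) /
            (qPoch q q (k - s) * qPoch q q (k + s))) / (1 - q ^ (2 * k + 2)) +
          2 * (-1) ^ (k + J + 1) /
            ((1 - q ^ (2 * k + 2)) * (qPoch q q (k - J) * qPoch q q (k + J + 1))) := by
      intro J hJ
      induction J with
      | zero =>
        have h1 := hne k (by omega)
        have h2 := hs (k + 1) (by omega) (by omega)
        have h3 := hs (2 * k + 2) (by omega) (by omega)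
        simp only [zero_add, Finset.sum_range_one, if_true, add_zero, Nat.sub_zero,
          qPoch_self_succ]
        rw [show 2 * k + 2 = (k + 1) * 2 by ring, pow_mul] at *
        generalize q ^ (k + 1) = x at *
        field_simp
        ring
      | succ J ihJ =>
        obtain ⟨d, rfl⟩ := Nat.exists_eq_add_of_lt hJ
        rw [Finset.sum_range_succ, ihJ (by omega), Finset.sum_range_succ _ (J + 1)]
        rw [show J + d + 1 + 1 - (J + 1) = d + 1 by omega,
          show J + d + 1 - (J + 1) = d by omega, show J + d + 1 - J = d + 1 by omega,
          show J + d + 1 + 1 + (J + 1) = (2 * J + d + 2) + 1 by ring,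
          show J + d + 1 + (J + 1) + 1 = (2 * J + d + 2) + 1 by ring,
          show J + d + 1 + (J + 1) = 2 * J + d + 2 by ring,
          show J + d + 1 + J + 1 = 2 * J + d + 2 by ring,
          show 2 * (J + d + 1) + 2 = (d + 1) + (2 * J + d + 2 + 1) by ring]
        have h1 := hne d (by omega)
        have h2 := hne (2 * J + d + 2) (by omega)
        have h3 := hs (d + 1) (by omega) (by omega)
        have h4 := hs (2 * J + d + 2 + 1) (by omega) (by omega)
        have h5 := hs ((d + 1) + (2 * J + d + 2 + 1)) (by omega) (by omega)
        rw [if_neg (by omega), qPoch_self_succ q d, qPoch_self_succ q (2 * J + d + 2),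
          pow_succ (-1 : ℂ) (2 * J + d + 2)]
        rw [pow_add q (d + 1)] at *
        generalize q ^ (d + 1) = x at *
        generalize q ^ (2 * J + d + 2 + 1) = y at *
        generalize qPoch q q d = A at *
        generalize qPoch q q (2 * J + d + 2) = B at *
        field_simp
        ring
    rw [Finset.sum_range_succ, partialSum k le_rfl, ih fun i h0 hi => h i h0 (by omega),
      qPoch_self_succ (q ^ 2), if_neg k.succ_ne_zero, Nat.sub_self, Nat.sub_self,
      show k + 1 + (k + 1) = (2 * k + 1) + 1 by ring, show k + k + 1 = 2 * k + 1 by ring,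
      qPoch_self_succ q (2 * k + 1), qPoch_zero, ← pow_mul,
      show 2 * (k + 1) = 2 * k + 1 + 1 by ring]
    have h1 := hne (2 * k + 1) (by omega)
    have h2 := hs (2 * k + 1 + 1) (by omega) (by omega)
    have : (-1 : ℂ) ^ (2 * k + 1 + 1) = - (-1) ^ (2 * k + 1) := by ring
    rw [this]
    generalize q ^ (2 * k + 1 + 1) = x at *
    field_simp
    ring

/-- A terminating `q`-analogue of Gauss's second summation theorem. -/
lemma sum_qPoch_mul_qPoch_div (q b : ℂ) (N : ℕ) (h : ∀ i, 0 < i → i ≤ 2 * N → q ^ i ≠ 1) :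
    ∑ j ∈ Finset.range (N + 1), qPoch q q (2 * N - j) * qPoch b q j * q ^ (j * (j + 1) / 2) /
        (qPoch q q j * qPoch (q ^ 2) (q ^ 2) (N - j)) =
      qPoch (b * q) (q ^ 2) N := by
  induction N with
  | zero => simp [qPoch_zero]
  | succ N ih =>
    have hne : ∀ i, i ≤ 2 * N + 2 → qPoch q q i ≠ 0 := fun i hi =>
      qPoch_self_ne_zero fun j hj hji => h j hj (by omega)
    have hs : ∀ i, 0 < i → i ≤ 2 * N + 2 → 1 - q ^ i ≠ 0 := fun i h0 hi =>
      sub_ne_zero.2 (h i h0 (by omega)).symm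
    have hne2 : ∀ i, i ≤ N + 1 → qPoch (q ^ 2) (q ^ 2) i ≠ 0 := fun i hi =>
      qPoch_self_ne_zero fun j hj hji => by rw [← pow_mul]; exact h _ (by omega) (by omega)
    have tri : ∀ j, (j + 1) * (j + 1 + 1) / 2 = j * (j + 1) / 2 + (j + 1) := fun j => by
      rw [show (j + 1) * (j + 1 + 1) = j * (j + 1) + (j + 1) * 2 by ring,
        Nat.add_mul_div_right _ _ two_pos]
    have partialSum : ∀ J ≤ N,
        ∑ j ∈ Finset.range (J + 1),
            qPoch q q (2 * (N + 1) - j) * qPoch b q j * q ^ (j * (j + 1) / 2) /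
            (qPoch q q j * qPoch (q ^ 2) (q ^ 2) (N + 1 - j)) =
          (∑ j ∈ Finset.range (J + 1),
            qPoch q q (2 * N - j) * qPoch b q j * q ^ (j * (j + 1) / 2) /
            (qPoch q q j * qPoch (q ^ 2) (q ^ 2) (N - j))) * (1 - b * q ^ (2 * N + 1)) -
          q ^ (2 * (N - J)) * qPoch q q (2 * N - J) * qPoch b q (J + 1) *
              q ^ ((J + 1) * (J + 1 + 1) / 2) /
            (qPoch q q J * qPoch (q ^ 2) (q ^ 2) (N - J)) := by
      intro J hJ
      induction J with
      | zero =>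
        have h1 := hne2 N (by omega)
        have h2 := hs (2 * N + 1 + 1) (by omega) (by omega)
        rw [zero_add, Finset.sum_range_one, Finset.sum_range_one, Nat.sub_zero, Nat.sub_zero,
          Nat.sub_zero, show 2 * (N + 1) = 2 * N + 1 + 1 by ring,
          qPoch_self_succ q (2 * N + 1), qPoch_self_succ q (2 * N), qPoch_self_succ (q ^ 2) N,
          qPoch_succ b q 0, ← pow_mul q 2, show 2 * (N + 1) = 2 * N + 1 + 1 by ring]
        simp only [qPoch_zero, Nat.zero_div, pow_zero, one_mul, mul_one, zero_add,
          show 1 * (1 + 1) / 2 = 1 by norm_num, pow_one]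
        clear ih hne hs hne2 tri
        generalize qPoch q q (2 * N) = A at *
        generalize qPoch (q ^ 2) (q ^ 2) N = B at *
        rw [show q ^ (2 * N + 1 + 1) = q ^ (2 * N) * q ^ 2 by ring] at *
        rw [show q ^ (2 * N + 1) = q ^ (2 * N) * q by ring]
        generalize q ^ (2 * N) = x at *
        generalize hd : 1 - x * q ^ 2 = d at *
        field_simp
        subst hd
        ring
      | succ J ihJ =>
        obtain ⟨d, rfl⟩ := Nat.exists_eq_add_of_lt hJ
        rw [Finset.sum_range_succ, ihJ (by omega), Finset.sum_range_succ _ (J + 1)]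
        rw [show J + d + 1 + 1 - (J + 1) = d + 1 by omega,
          show J + d + 1 - (J + 1) = d by omega, show J + d + 1 - J = d + 1 by omega,
          show 2 * (J + d + 1 + 1) - (J + 1) = (J + 2 * d + 1) + 1 + 1 by omega,
          show 2 * (J + d + 1) - (J + 1) = J + 2 * d + 1 by omega,
          show 2 * (J + d + 1) - J = J + 2 * d + 1 + 1 by omega]
        have h1 := hne2 d (by omega)
        have h2 := hne J (by omega)
        have h3 := hs (2 * (d + 1)) (by omega) (by omega)
        have h4 := hs (J + 1) (by omega) (by omega)
        rw [qPoch_self_succ q J, qPoch_self_succ q (J + 2 * d + 1 + 1),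
          qPoch_self_succ q (J + 2 * d + 1), qPoch_self_succ (q ^ 2) d, qPoch_succ b q (J + 1),
          tri (J + 1), ← pow_mul q 2]
        clear ih ihJ hne hs hne2 tri
        generalize qPoch q q (J + 2 * d + 1) = A at *
        generalize qPoch q q J = A' at *
        generalize qPoch (q ^ 2) (q ^ 2) d = B at *
        generalize qPoch b q (J + 1) = C at *
        generalize (J + 1) * (J + 1 + 1) / 2 = e at *
        rw [show q ^ (2 * (d + 1)) = (q ^ d) ^ 2 * q ^ 2 by ring] at *
        rw [show q ^ (J + 1) = q ^ J * q by ring] at *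
        rw [show q ^ (J + 2 * d + 1 + 1 + 1) = q ^ J * (q ^ d) ^ 2 * q ^ 3 by ring,
          show q ^ (J + 2 * d + 1 + 1) = q ^ J * (q ^ d) ^ 2 * q ^ 2 by ring,
          show q ^ (2 * (J + d + 1) + 1) = (q ^ J) ^ 2 * (q ^ d) ^ 2 * q ^ 3 by ring,
          show q ^ (2 * d) = (q ^ d) ^ 2 by ring, pow_add q e,
          show q ^ (J + 1 + 1) = q ^ J * q ^ 2 by ring]
        generalize q ^ e = E
        generalize q ^ J = X at *
        generalize q ^ d = D at *
        generalize (Finset.sum (Finset.range (J + 1)) _ : ℂ) = S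
        generalize hd3 : 1 - D ^ 2 * q ^ 2 = d3 at *
        generalize hd4 : 1 - X * q = d4 at *
        field_simp
        subst hd3 hd4
        ring
    rw [Finset.sum_range_succ, partialSum N le_rfl, ih fun i h0 hi => h i h0 (by omega),
      qPoch_succ (b * q), show 2 * (N + 1) - (N + 1) = N + 1 by omega,
      show 2 * N - N = N by omega, Nat.sub_self, Nat.sub_self, qPoch_zero, ← pow_mul]
    have h1 := hne N (by omega)
    have h2 := hne (N + 1) (by omega)
    field_simp
    ring

/-- The partial sums obtained by inserting the Bailey pair with
`β_k = 1 / ((q²;q²)_k (-q;q)_{2k+1})`, where `q = p²`. -/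
lemma sum_bailey_pair (p : ℂ) (k : ℕ) (h : ∀ i, 0 < i → i ≤ 2 * k → (p ^ 4) ^ i ≠ 1)
    (hp : ∀ i, 1 + (p ^ 2) ^ i ≠ 0) :
    ∑ r ∈ Finset.range k, (-1) ^ r * p ^ (3 * r ^ 2 + r) * (1 - (p ^ 2) ^ (2 * r + 1)) /
        (qPoch (p ^ 4) (p ^ 4) (k - r) * qPoch (p ^ 4) (p ^ 4) (k + r + 1)) +
      (-1) ^ k * p ^ (3 * k ^ 2 + k) /
        ((1 + (p ^ 2) ^ (2 * k + 1)) * qPoch (p ^ 4) (p ^ 4) (2 * k)) =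
      (qPoch (p ^ 4) (p ^ 4) k * qPoch (-p ^ 2) (p ^ 2) (2 * k + 1))⁻¹ := by
  induction k with
  | zero =>
    simp [qPoch_zero, qPoch_succ]
  | succ k ih =>
    have hne : ∀ i, i ≤ 2 * k + 2 → qPoch (p ^ 4) (p ^ 4) i ≠ 0 := fun i hi =>
      qPoch_self_ne_zero fun j hj hji => h j hj (by omega)
    have hs : ∀ i, 0 < i → i ≤ 2 * k + 2 → 1 - (p ^ 4) ^ i ≠ 0 := fun i h0 hi =>
      sub_ne_zero.2 (h i h0 (by omega)).symm
    have partialSum : ∀ J ≤ k,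
        ∑ r ∈ Finset.range (J + 1), (-1) ^ r * p ^ (3 * r ^ 2 + r) *
            (1 - (p ^ 2) ^ (2 * r + 1)) /
            (qPoch (p ^ 4) (p ^ 4) (k + 1 - r) * qPoch (p ^ 4) (p ^ 4) (k + 1 + r + 1)) =
          (∑ r ∈ Finset.range (J + 1), (-1) ^ r * p ^ (3 * r ^ 2 + r) *
            (1 - (p ^ 2) ^ (2 * r + 1)) /
            (qPoch (p ^ 4) (p ^ 4) (k - r) * qPoch (p ^ 4) (p ^ 4) (k + r + 1)) -
          (-1) ^ J * p ^ (3 * J * (J + 1)) * (p ^ 2) ^ (2 * k + 2) *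
            ((p ^ 2) ^ (3 * (J + 1)) - 1 +
              (p ^ 2) ^ (2 * k + 2) * ((p ^ 2) ^ (2 * (J + 1)) - (p ^ 2) ^ (J + 1))) /
            (qPoch (p ^ 4) (p ^ 4) (k - J) * qPoch (p ^ 4) (p ^ 4) (k + J + 2))) /
          ((1 - (p ^ 4) ^ (k + 1)) * (1 + (p ^ 2) ^ (2 * k + 2)) *
            (1 + (p ^ 2) ^ (2 * k + 3))) := by
      intro J hJ
      have e1 := hp (2 * k + 2)
      have e2 := hp (2 * k + 3)
      induction J with
      | zero =>
        have h1 := hne k (by omega)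
        have h2 := hs (k + 1) (by omega) (by omega)
        have h3 := hs (k + 1 + 1) (by omega) (by omega)
        rw [zero_add, Finset.sum_range_one, Finset.sum_range_one]
        simp only [Nat.sub_zero, add_zero, zero_add, mul_zero, pow_zero, one_mul, mul_one,
          ne_eq, OfNat.ofNat_ne_zero, not_false_eq_true, zero_pow]
        rw [show k + 2 = k + 1 + 1 by ring, qPoch_self_succ _ (k + 1), qPoch_self_succ]
        clear ih hne hs
        generalize qPoch (p ^ 4) (p ^ 4) k = A at *
        rw [show (p ^ 4) ^ (k + 1 + 1) = (p ^ k) ^ 4 * p ^ 8 by ring] at *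
        rw [show (p ^ 4) ^ (k + 1) = (p ^ k) ^ 4 * p ^ 4 by ring] at *
        rw [show (p ^ 2) ^ (2 * k + 2) = (p ^ k) ^ 4 * p ^ 4 by ring] at *
        rw [show (p ^ 2) ^ (2 * k + 3) = (p ^ k) ^ 4 * p ^ 6 by ring] at *
        generalize p ^ k = x at *
        generalize hd1 : 1 + x ^ 4 * p ^ 4 = d1 at *
        generalize hd2 : 1 + x ^ 4 * p ^ 6 = d2 at *
        generalize hd3 : 1 - x ^ 4 * p ^ 4 = d3 at *
        generalize hd4 : 1 - x ^ 4 * p ^ 8 = d4 at *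
        field_simp
        subst hd1 hd2 hd3 hd4
        ring
      | succ J ihJ =>
        obtain ⟨d, rfl⟩ := Nat.exists_eq_add_of_lt hJ
        rw [Finset.sum_range_succ, ihJ (by omega), Finset.sum_range_succ _ (J + 1)]
        rw [show J + d + 1 + 1 - (J + 1) = d + 1 by omega,
          show J + d + 1 - (J + 1) = d by omega, show J + d + 1 - J = d + 1 by omega,
          show J + d + 1 + 1 + (J + 1) + 1 = (2 * J + d + 3) + 1 by ring,
          show J + d + 1 + (J + 1) + 2 = (2 * J + d + 3) + 1 by ring,
          show J + d + 1 + (J + 1) + 1 = 2 * J + d + 3 by ring,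
          show J + d + 1 + J + 2 = 2 * J + d + 3 by ring]
        have h1 := hne d (by omega)
        have h2 := hne (2 * J + d + 3) (by omega)
        have h3 := hs (d + 1) (by omega) (by omega)
        have h4 := hs (2 * J + d + 3 + 1) (by omega) (by omega)
        have h5 := hs (J + d + 1 + 1) (by omega) (by omega)
        rw [qPoch_self_succ _ d, qPoch_self_succ _ (2 * J + d + 3)]
        clear ih ihJ hne hs
        generalize qPoch (p ^ 4) (p ^ 4) d = A at *
        generalize qPoch (p ^ 4) (p ^ 4) (2 * J + d + 3) = B at *
        rw [show (p ^ 4) ^ (d + 1) = (p ^ d) ^ 4 * p ^ 4 by ring] at *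
        rw [show (p ^ 4) ^ (2 * J + d + 3 + 1) = (p ^ J) ^ 8 * (p ^ d) ^ 4 * p ^ 16 by ring] at *
        rw [show (p ^ 4) ^ (J + d + 1 + 1) = (p ^ J) ^ 4 * (p ^ d) ^ 4 * p ^ 8 by ring] at *
        rw [show (p ^ 2) ^ (2 * (J + d + 1) + 2) = (p ^ J) ^ 4 * (p ^ d) ^ 4 * p ^ 8 by ring] at *
        rw [show (p ^ 2) ^ (2 * (J + d + 1) + 3) = (p ^ J) ^ 4 * (p ^ d) ^ 4 * p ^ 10 by ring] at *
        rw [show p ^ (3 * (J + 1) ^ 2 + (J + 1)) = p ^ (3 * J * (J + 1)) * (p ^ J) ^ 4 * p ^ 4 by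
            ring,
          show p ^ (3 * (J + 1) * (J + 1 + 1)) = p ^ (3 * J * (J + 1)) * (p ^ J) ^ 6 * p ^ 6 by
            ring,
          show (p ^ 2) ^ (2 * (J + 1) + 1) = (p ^ J) ^ 4 * p ^ 6 by ring,
          show (p ^ 2) ^ (3 * (J + 1)) = (p ^ J) ^ 6 * p ^ 6 by ring,
          show (p ^ 2) ^ (2 * (J + 1)) = (p ^ J) ^ 4 * p ^ 4 by ring,
          show (p ^ 2) ^ (J + 1) = (p ^ J) ^ 2 * p ^ 2 by ring,
          show (p ^ 2) ^ (3 * (J + 1 + 1)) = (p ^ J) ^ 6 * p ^ 12 by ring,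
          show (p ^ 2) ^ (2 * (J + 1 + 1)) = (p ^ J) ^ 4 * p ^ 8 by ring,
          show (p ^ 2) ^ (J + 1 + 1) = (p ^ J) ^ 2 * p ^ 4 by ring, pow_succ (-1 : ℂ) J]
        generalize p ^ (3 * J * (J + 1)) = E
        generalize (-1 : ℂ) ^ J = s
        generalize p ^ J = X at *
        generalize p ^ d = D at *
        generalize (Finset.sum (Finset.range (J + 1)) _ : ℂ) = S
        generalize hd1 : 1 - D ^ 4 * p ^ 4 = d1 at *
        generalize hd2 : 1 + X ^ 4 * D ^ 4 * p ^ 8 = d2 at *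
        generalize hd3 : 1 + X ^ 4 * D ^ 4 * p ^ 10 = d3 at *
        generalize hd4 : 1 - X ^ 8 * D ^ 4 * p ^ 16 = d4 at *
        generalize hd5 : 1 - X ^ 4 * D ^ 4 * p ^ 8 = d5 at *
        field_simp
        subst hd1 hd2 hd3 hd4 hd5
        ring
    have diag : ∀ x A : ℂ, 1 - x ^ 2 ≠ 0 → (1 - x) / (A * (1 - x ^ 2)) = 1 / ((1 + x) * A) := by
      intro x A hx
      rcases eq_or_ne A 0 with rfl | hA
      · simp
      have h1 : 1 - x ≠ 0 := fun h0 => hx (by linear_combination (1 + x) * h0)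
      have h2 : 1 + x ≠ 0 := fun h0 => hx (by linear_combination (1 - x) * h0)
      field_simp
      ring
    have hreg : ∑ r ∈ Finset.range (k + 1), (-1) ^ r * p ^ (3 * r ^ 2 + r) *
            (1 - (p ^ 2) ^ (2 * r + 1)) /
            (qPoch (p ^ 4) (p ^ 4) (k - r) * qPoch (p ^ 4) (p ^ 4) (k + r + 1)) =
        (qPoch (p ^ 4) (p ^ 4) k * qPoch (-p ^ 2) (p ^ 2) (2 * k + 1))⁻¹ := by
      rw [← ih fun i h0 hi => h i h0 (by omega), Finset.sum_range_succ, Nat.sub_self, qPoch_zero,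
        one_mul, ← two_mul, qPoch_self_succ]
      have h1 := diag ((p ^ 2) ^ (2 * k + 1)) (qPoch (p ^ 4) (p ^ 4) (2 * k)) (by
        have := hs (2 * k + 1) (by omega) (by omega)
        rwa [show ((p ^ 2) ^ (2 * k + 1)) ^ 2 = (p ^ 4) ^ (2 * k + 1) by ring])
      rw [show ((p ^ 2) ^ (2 * k + 1)) ^ 2 = (p ^ 4) ^ (2 * k + 1) by ring] at h1
      rw [mul_div_assoc, h1, mul_one_div]
    have hβ : qPoch (-p ^ 2) (p ^ 2) (2 * k + 1) ≠ 0 := by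
      refine Finset.prod_ne_zero_iff.2 fun i _ => ?_
      have := hp (i + 1)
      rwa [pow_succ', ← sub_neg_eq_add, ← neg_mul] at this
    rw [partialSum k le_rfl, hreg, Nat.sub_self, qPoch_zero,
      show 2 * (k + 1) + 1 = 2 * k + 1 + 1 + 1 by ring, qPoch_succ _ _ (2 * k + 1 + 1),
      qPoch_succ _ _ (2 * k + 1), qPoch_self_succ _ k, show k + k + 2 = 2 * (k + 1) by ring]
    have h1 := hne k (by omega)
    have h2 := hne (2 * (k + 1)) (by omega)
    have h3 := hs (k + 1) (by omega) (by omega)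
    have h4 := hp (2 * k + 2)
    have h5 := hp (2 * k + 3)
    clear ih hreg diag partialSum hne hs
    generalize qPoch (p ^ 4) (p ^ 4) k = A at *
    generalize qPoch (p ^ 4) (p ^ 4) (2 * (k + 1)) = B at *
    generalize qPoch (-p ^ 2) (p ^ 2) (2 * k + 1) = C at *
    rw [show 1 - -p ^ 2 * (p ^ 2) ^ (2 * k + 1) = 1 + (p ^ 2) ^ (2 * k + 2) by ring,
      show 1 - -p ^ 2 * (p ^ 2) ^ (2 * k + 1 + 1) = 1 + (p ^ 2) ^ (2 * k + 3) by ring,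
      show 2 * k + 1 + 1 + 1 = 2 * k + 3 by ring]
    rw [show p ^ (3 * (k + 1) ^ 2 + (k + 1)) = p ^ (3 * k * (k + 1)) * (p ^ k) ^ 4 * p ^ 4 by
            ring,
          show (p ^ 2) ^ (3 * (k + 1)) = (p ^ k) ^ 6 * p ^ 6 by ring,
          show (p ^ 2) ^ (2 * (k + 1)) = (p ^ k) ^ 4 * p ^ 4 by ring,
          show (p ^ 2) ^ (k + 1) = (p ^ k) ^ 2 * p ^ 2 by ring, pow_succ (-1 : ℂ) k]
    rw [show (p ^ 2) ^ (2 * k + 2) = (p ^ k) ^ 4 * p ^ 4 by ring] at *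
    rw [show (p ^ 2) ^ (2 * k + 3) = (p ^ k) ^ 4 * p ^ 6 by ring] at *
    rw [show (p ^ 4) ^ (k + 1) = (p ^ k) ^ 4 * p ^ 4 by ring] at *
    generalize p ^ (3 * k * (k + 1)) = E
    generalize (-1 : ℂ) ^ k = s
    generalize p ^ k = X at *
    generalize hd1 : 1 + X ^ 4 * p ^ 4 = d1 at *
    generalize hd2 : 1 + X ^ 4 * p ^ 6 = d2 at *
    generalize hd3 : 1 - X ^ 4 * p ^ 4 = d3 at *
    field_simp
    subst hd1 hd2 hd3
    ring

lemma qPoch_self_two_mul (q : ℂ) (k : ℕ) :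
    qPoch q q (2 * k) = qPoch q (q ^ 2) k * qPoch (q ^ 2) (q ^ 2) k := by
  induction k with
  | zero => simp [qPoch_zero]
  | succ k ih =>
    rw [show 2 * (k + 1) = 2 * k + 1 + 1 by ring, qPoch_self_succ, qPoch_self_succ, ih, qPoch_succ q,
      qPoch_self_succ (q ^ 2), ← pow_mul, ← pow_mul]
    ring

lemma IsPrimitiveRoot.qPoch_self_eq {q : ℂ} {n : ℕ} (hq : IsPrimitiveRoot q (n + 1)) :
    qPoch q q n = n + 1 := by
  rw [← hq.prod_one_sub_pow_eq_order, qPoch]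
  simp only [pow_succ']

/-- The weights attached to the terms of the Bailey pair of `sum_bailey_pair` sum to one at a root
of unity of odd order. -/
lemma sum_bailey_weight {q : ℂ} {m : ℕ} (hq : IsPrimitiveRoot q (2 * m + 1)) (d r : ℕ)
    (hr : r + d + 1 = m) :
    ∑ i ∈ Finset.range (d + 2), q ^ i * qPoch q (q ^ 2) (r + i) * qPoch (q ^ 2) (q ^ 2) (r + i) *
        (1 - q ^ (2 * r + 1)) /
        (qPoch (q ^ 2) (q ^ 2) i * qPoch (q ^ 2) (q ^ 2) (2 * r + i + 1)) = 1 := by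
  have hq2 : IsPrimitiveRoot (q ^ 2) (2 * m + 1) :=
    hq.pow_of_coprime 2 (by simp)
  have hs : ∀ i, 0 < i → i ≤ 2 * m → 1 - (q ^ 2) ^ i ≠ 0 := fun i h0 hi =>
    sub_ne_zero.2 (hq2.pow_ne_one_of_pos_of_lt h0.ne' (by omega)).symm
  have hne : ∀ i, i ≤ 2 * m → qPoch (q ^ 2) (q ^ 2) i ≠ 0 := fun i hi =>
    qPoch_self_ne_zero fun j h0 hj => hq2.pow_ne_one_of_pos_of_lt h0.ne' (by omega)
  induction d generalizing r with
  | zero =>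
    subst hr
    have hG : qPoch q (q ^ 2) (r + 1) * qPoch (q ^ 2) (q ^ 2) (r + 1) =
        qPoch (q ^ 2) (q ^ 2) (2 * r + 1) * (1 - (q ^ 2) ^ (2 * r + 1 + 1)) := by
      rw [← qPoch_self_two_mul, ← qPoch_self_succ (q ^ 2) (2 * r + 1)]
      exact hq.qPoch_self_eq.trans hq2.qPoch_self_eq.symm
    have h1 := hne (2 * r + 1) (by omega)
    have h2 := hs 1 (by omega) (by omega)
    have h3 := hs (r + 1) (by omega) (by omega)
    have h4 := hs (2 * r + 1 + 1) (by omega) (by omega)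
    have hx : q ^ (2 * r) * q ^ 3 = 1 := by rw [← pow_add]; exact hq.pow_eq_one
    have hH : qPoch q (q ^ 2) r * qPoch (q ^ 2) (q ^ 2) r * (1 - q ^ (2 * r + 1)) =
        qPoch (q ^ 2) (q ^ 2) (2 * r + 1) * (1 + (q ^ 2) ^ (r + 1)) := by
      refine mul_right_cancel₀ h3 ?_
      rw [qPoch_succ, qPoch_self_succ (q ^ 2)] at hG
      rw [← pow_mul q 2 r, ← pow_succ'] at hG
      rw [show (1 - (q ^ 2) ^ (2 * r + 1 + 1)) =
        (1 + (q ^ 2) ^ (r + 1)) * (1 - (q ^ 2) ^ (r + 1)) by ring] at hG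
      linear_combination hG
    rw [zero_add, Finset.sum_range_succ, Finset.sum_range_one, pow_zero, one_mul, add_zero,
      qPoch_zero, hH, add_zero, show q ^ 1 * qPoch q (q ^ 2) (r + 1) *
        qPoch (q ^ 2) (q ^ 2) (r + 1) = q * (qPoch q (q ^ 2) (r + 1) *
        qPoch (q ^ 2) (q ^ 2) (r + 1)) by ring, hG, qPoch_self_succ _ (2 * r + 1),
      show qPoch (q ^ 2) (q ^ 2) 1 = 1 - (q ^ 2) ^ 1 by simp [qPoch]]
    clear hH hG h3 hs hne hq2
    generalize qPoch (q ^ 2) (q ^ 2) (2 * r + 1) = A at *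
    generalize (1 - (q ^ 2) ^ (2 * r + 1 + 1)) = B at *
    rw [show (q ^ 2) ^ (r + 1) = q ^ (2 * r) * q ^ 2 by ring,
      show q ^ (2 * r + 1) = q ^ (2 * r) * q by ring]
    generalize q ^ (2 * r) = x at *
    rw [pow_one] at *
    generalize hd : 1 - q ^ 2 = d at *
    field_simp
    subst hd
    linear_combination -q * hx
  | succ d ih =>
    have telescope : ∀ J, 2 * r + J + 2 ≤ 2 * m →
        ∑ i ∈ Finset.range J, q ^ i * qPoch q (q ^ 2) (r + 1 + i) *
            qPoch (q ^ 2) (q ^ 2) (r + 1 + i) * (1 - q ^ (2 * (r + 1) + 1)) /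
            (qPoch (q ^ 2) (q ^ 2) i * qPoch (q ^ 2) (q ^ 2) (2 * (r + 1) + i + 1)) =
          ∑ i ∈ Finset.range (J + 1), q ^ i * qPoch q (q ^ 2) (r + i) *
            qPoch (q ^ 2) (q ^ 2) (r + i) * (1 - q ^ (2 * r + 1)) /
            (qPoch (q ^ 2) (q ^ 2) i * qPoch (q ^ 2) (q ^ 2) (2 * r + i + 1)) -
          (1 + q ^ (2 * r + 2)) * q ^ J * qPoch q (q ^ 2) (r + J + 1) *
            qPoch (q ^ 2) (q ^ 2) (r + J + 1) /
            (qPoch (q ^ 2) (q ^ 2) J * qPoch (q ^ 2) (q ^ 2) (2 * r + J + 2)) := by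
      intro J hJ
      induction J with
      | zero =>
        have h1 := hne (2 * r + 1) (by omega)
        have h2 := hs (2 * r + 1 + 1) (by omega) (by omega)
        rw [Finset.sum_range_zero, zero_add, Finset.sum_range_one]
        simp only [add_zero]
        rw [show 2 * r + 2 = 2 * r + 1 + 1 by ring, qPoch_self_succ _ (2 * r + 1),
          qPoch_self_succ _ r, qPoch_succ q _ r, qPoch_zero]
        rw [show (q ^ 2) ^ (2 * r + 1 + 1) = (q ^ r) ^ 4 * q ^ 4 by ring] at *
        rw [show (q ^ 2) ^ (r + 1) = (q ^ r) ^ 2 * q ^ 2 by ring,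
          show (q ^ 2) ^ r = (q ^ r) ^ 2 by ring,
          show q ^ (2 * r + 1 + 1) = (q ^ r) ^ 2 * q ^ 2 by ring,
          show q ^ (2 * r + 1) = (q ^ r) ^ 2 * q by ring]
        clear ih hs hne
        generalize q ^ r = x at *
        generalize hd : 1 - x ^ 4 * q ^ 4 = d at *
        field_simp
        subst hd
        ring
      | succ J ihJ =>
        have h1 := hne (2 * r + J + 2) (by omega)
        have h2 := hs (2 * r + J + 2 + 1) (by omega) (by omega)
        have h3 := hne J (by omega)
        have h4 := hs (J + 1) (by omega) (by omega)
        rw [Finset.sum_range_succ, ihJ (by omega), Finset.sum_range_succ _ (J + 1)]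
        rw [show 2 * (r + 1) + J + 1 = 2 * r + J + 2 + 1 by ring,
          show 2 * r + (J + 1) + 2 = 2 * r + J + 2 + 1 by ring,
          show 2 * r + (J + 1) + 1 = 2 * r + J + 2 by ring,
          show r + 1 + J = r + J + 1 by ring, show r + (J + 1) = r + J + 1 by ring,
          qPoch_self_succ _ (2 * r + J + 2), qPoch_self_succ _ J, qPoch_self_succ _ (r + J + 1),
          qPoch_succ q _ (r + J + 1)]
        clear ih ihJ hs hne
        generalize (Finset.sum (Finset.range (J + 1)) _ : ℂ) = S
        generalize qPoch (q ^ 2) (q ^ 2) (2 * r + J + 2) = A at *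
        generalize qPoch (q ^ 2) (q ^ 2) J = B at *
        generalize qPoch (q ^ 2) (q ^ 2) (r + J + 1) = C at *
        generalize qPoch q (q ^ 2) (r + J + 1) = D at *
        rw [show (q ^ 2) ^ (2 * r + J + 2 + 1) = (q ^ r) ^ 4 * (q ^ J) ^ 2 * q ^ 6 by ring] at *
        rw [show (q ^ 2) ^ (J + 1) = (q ^ J) ^ 2 * q ^ 2 by ring] at *
        rw [show (q ^ 2) ^ (r + J + 1 + 1) = (q ^ r) ^ 2 * (q ^ J) ^ 2 * q ^ 4 by ring,
          show (q ^ 2) ^ (r + J + 1) = (q ^ r) ^ 2 * (q ^ J) ^ 2 * q ^ 2 by ring,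
          show q ^ (2 * (r + 1) + 1) = (q ^ r) ^ 2 * q ^ 3 by ring,
          show q ^ (2 * r + 2) = (q ^ r) ^ 2 * q ^ 2 by ring,
          show q ^ (2 * r + 1) = (q ^ r) ^ 2 * q by ring,
          show q ^ (J + 1) = q ^ J * q by ring]
        generalize q ^ r = x at *
        generalize q ^ J = y at *
        generalize hd1 : 1 - x ^ 4 * y ^ 2 * q ^ 6 = d1 at *
        generalize hd2 : 1 - y ^ 2 * q ^ 2 = d2 at *
        field_simp
        subst hd1 hd2
        ring
    have h0 : qPoch q (q ^ 2) (r + (d + 2) + 1) = 0 := by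
      rw [qPoch_succ, ← pow_mul, ← pow_succ', show 2 * (r + (d + 2)) + 1 = 2 * m + 1 by omega,
        hq.pow_eq_one, sub_self, mul_zero]
    have h := telescope (d + 2) (by omega)
    rw [ih (r + 1) (by omega), h0, mul_zero, zero_mul, zero_div, sub_zero] at h
    exact h.symm

lemma sum_range_add_diag (f : ℕ → ℕ → ℂ) (m : ℕ) :
    ∑ k ∈ Finset.range (m + 1), ∑ r ∈ Finset.range k, f r k + ∑ r ∈ Finset.range m, f r r =
      ∑ r ∈ Finset.range m, ∑ i ∈ Finset.range (m - r + 1), f r (r + i) := by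
  induction m with
  | zero => simp
  | succ m ih =>
    have hcol : ∀ r ∈ Finset.range m, ∑ i ∈ Finset.range (m + 1 - r + 1), f r (r + i) =
        ∑ i ∈ Finset.range (m - r + 1), f r (r + i) + f r (m + 1) := fun r hr => by
      have := Finset.mem_range.1 hr
      rw [Finset.sum_range_succ, show m + 1 - r = m - r + 1 by omega,
        show r + (m - r + 1) = m + 1 by omega]
    rw [Finset.sum_range_succ _ (m + 1), Finset.sum_range_succ (fun r => f r r),
      Finset.sum_range_succ (fun r => ∑ i ∈ Finset.range (m + 1 - r + 1), f r (r + i)),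
      Finset.sum_congr rfl hcol, Finset.sum_add_distrib, ← ih,
      show m + 1 - m + 1 = 2 by omega, Finset.sum_range_succ _ 1, Finset.sum_range_one, add_zero,
      Finset.sum_range_succ (fun r => f r (m + 1))]
    ring

lemma pow_eq_pow_of_add_mul_eq {p : ℂ} {n a b x y : ℕ} (hp : p ^ n = 1)
    (h : a + n * x = b + n * y) : p ^ a = p ^ b := by
  simpa [pow_add, pow_mul, hp] using congrArg (p ^ ·) h

lemma one_add_ne_zero_of_pow_eq_one {x : ℂ} {n : ℕ} (hn : Odd n) (hx : x ^ n = 1) :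
    1 + x ≠ 0 := fun h => by
  rw [eq_neg_of_add_eq_zero_right h, hn.neg_one_pow] at hx
  norm_num at hx

lemma sum_qPoch_div_eq_sum_theta {p : ℂ} {m : ℕ} (hp : IsPrimitiveRoot p (2 * m + 1)) :
    ∑ k ∈ Finset.range (m + 1), (p ^ 2) ^ k * qPoch (p ^ 2) (p ^ 4) k /
        qPoch (-p ^ 2) (p ^ 2) (2 * k + 1) =
      ∑ r ∈ Finset.range m, (-1) ^ r * p ^ (3 * r ^ 2 + 3 * r) +
        (-1) ^ m * p ^ (3 * m ^ 2 + 3 * m) / 2 := by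
  have hodd : Odd (2 * m + 1) := odd_two_mul_add_one m
  have hp2 : IsPrimitiveRoot (p ^ 2) (2 * m + 1) := hp.pow_of_coprime 2 (by simp)
  have hp4 : IsPrimitiveRoot (p ^ 4) (2 * m + 1) := by
    rw [show p ^ 4 = (p ^ 2) ^ 2 by ring]
    exact hp2.pow_of_coprime 2 (by simp)
  have h1 : ∀ i, 0 < i → i ≤ 2 * m → (p ^ 4) ^ i ≠ 1 := fun i h0 hi =>
    hp4.pow_ne_one_of_pos_of_lt h0.ne' (by omega)
  have h2 : ∀ i, 1 + (p ^ 2) ^ i ≠ 0 := fun i =>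
    one_add_ne_zero_of_pow_eq_one hodd (by rw [pow_right_comm, hp2.pow_eq_one, one_pow])
  have hne : ∀ i, i ≤ 2 * m → qPoch (p ^ 4) (p ^ 4) i ≠ 0 := fun i hi =>
    qPoch_self_ne_zero fun j h0 hj => h1 j h0 (by omega)
  set f : ℕ → ℕ → ℂ := fun r k => (-1) ^ r * p ^ (3 * r ^ 2 + r) * (p ^ 2) ^ k *
    (qPoch (p ^ 2) (p ^ 4) k * qPoch (p ^ 4) (p ^ 4) k) * (1 - (p ^ 2) ^ (2 * r + 1)) /
    (qPoch (p ^ 4) (p ^ 4) (k - r) * qPoch (p ^ 4) (p ^ 4) (k + r + 1)) with hf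
  set g : ℕ → ℂ := fun k => (-1) ^ k * p ^ (3 * k ^ 2 + k) * (p ^ 2) ^ k *
    (qPoch (p ^ 2) (p ^ 4) k * qPoch (p ^ 4) (p ^ 4) k) /
    ((1 + (p ^ 2) ^ (2 * k + 1)) * qPoch (p ^ 4) (p ^ 4) (2 * k)) with hg
  have hterm : ∀ k ∈ Finset.range (m + 1), (p ^ 2) ^ k * qPoch (p ^ 2) (p ^ 4) k /
      qPoch (-p ^ 2) (p ^ 2) (2 * k + 1) = ∑ r ∈ Finset.range k, f r k + g k := fun k hk => by
    have hk := Finset.mem_range.1 hk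
    have hb := sum_bailey_pair p k (fun i h0 hi => h1 i h0 (by omega)) h2
    have h3 := hne k (by omega)
    calc _ = (p ^ 2) ^ k * qPoch (p ^ 2) (p ^ 4) k * qPoch (p ^ 4) (p ^ 4) k *
          (qPoch (p ^ 4) (p ^ 4) k * qPoch (-p ^ 2) (p ^ 2) (2 * k + 1))⁻¹ := by
            rw [mul_inv]
            field_simp
      _ = _ := by
        rw [← hb, mul_add, Finset.mul_sum]
        congr 1
        · refine Finset.sum_congr rfl fun r _ => ?_
          simp only [hf]
          ring
        · simp only [hg]
          ring
  have hdiag : ∀ k ∈ Finset.range m, g k = f k k := fun k hk => by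
    have hk := Finset.mem_range.1 hk
    have h3 := hne (2 * k) (by omega)
    have h4 := sub_ne_zero.2 (h1 (2 * k + 1) (by omega) (by omega)).symm
    have h5 := h2 (2 * k + 1)
    simp only [hf, hg]
    rw [Nat.sub_self, qPoch_zero, ← two_mul, qPoch_self_succ _ (2 * k)]
    rw [show (p ^ 4) ^ (2 * k + 1) = ((p ^ 2) ^ (2 * k + 1)) ^ 2 by ring] at *
    generalize (p ^ 2) ^ (2 * k + 1) = x at *
    rw [show 1 - x ^ 2 = (1 + x) * (1 - x) by ring] at *
    have h6 := right_ne_zero_of_mul h4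
    field_simp
  have hlast : g m = (-1) ^ m * p ^ (3 * m ^ 2 + 3 * m) / 2 := by
    have h3 := hne (2 * m) le_rfl
    have h4 := qPoch_self_two_mul (p ^ 2) m
    rw [hp2.qPoch_self_eq, ← hp4.qPoch_self_eq, ← pow_mul p 2 2] at h4
    simp only [hg]
    rw [← h4, hp2.pow_eq_one]
    field_simp
    ring
  have hrow : ∀ r ∈ Finset.range m, ∑ i ∈ Finset.range (m - r + 1), f r (r + i) =
      (-1) ^ r * p ^ (3 * r ^ 2 + 3 * r) := fun r hr => by
    obtain ⟨d, hd⟩ := Nat.exists_eq_add_of_lt (Finset.mem_range.1 hr)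
    have h := sum_bailey_weight hp2 d r hd.symm
    rw [← pow_mul p 2 2] at h
    refine Eq.trans ?_ ((congrArg ((-1) ^ r * p ^ (3 * r ^ 2 + 3 * r) * ·) h).trans (mul_one _))
    rw [Finset.mul_sum, show m - r + 1 = d + 2 by omega]
    refine Finset.sum_congr rfl fun i _ => ?_
    simp only [hf]
    rw [show r + i - r = i by omega, show r + i + r + 1 = 2 * r + i + 1 by ring]
    ring
  rw [Finset.sum_congr rfl hterm, Finset.sum_add_distrib, Finset.sum_range_succ g,
    Finset.sum_congr rfl hdiag, hlast, ← add_assoc, sum_range_add_diag,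
    Finset.sum_congr rfl hrow]

/-- The `ψ` side: a half theta sum in `ζ⁻¹`. -/
lemma two_inv_mul_psi_eq {ζ : ℂ} {m : ℕ} (hζ : IsPrimitiveRoot ζ (2 * m + 1)) :
    2 * ζ⁻¹ * ∑ k ∈ Finset.range (m + 1), (-1 : ℂ) ^ k * ζ ^ (2 * (k + 1) ^ 2) *
        qPoch (ζ ^ 2) (ζ ^ 4) k / qPoch (-ζ ^ 2) (ζ ^ 2) (2 * k + 1) =
      ∑ j ∈ Finset.range (m + 1), (if j = 0 then 1 else 2) * (-1) ^ (m + j) *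
        ζ⁻¹ ^ (m ^ 2 + 3 * j ^ 2) := by
  have hζ0 : ζ ≠ 0 := hζ.ne_zero (by omega)
  have hp := hζ.inv
  have hpow := hp.pow_eq_one
  have hinv : ∀ i, ζ ^ i * ζ⁻¹ ^ i = 1 := fun i => by
    rw [← mul_pow, mul_inv_cancel₀ hζ0, one_pow]
  obtain ⟨p, hpdef⟩ : ∃ p, p = ζ⁻¹ := ⟨_, rfl⟩
  rw [← hpdef] at hp hpow
  simp only [← hpdef] at hinv ⊢
  have hnum : ∀ k, qPoch (ζ ^ 2) (ζ ^ 4) k =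
      (-1) ^ k * ζ ^ (2 * k ^ 2) * qPoch (p ^ 2) (p ^ 4) k := fun k => by
    induction k with
    | zero => simp [qPoch_zero]
    | succ k ih =>
      rw [qPoch_succ, qPoch_succ, ih]
      linear_combination -((-1) ^ k * ζ ^ (2 * k ^ 2) * qPoch (p ^ 2) (p ^ 4) k) *
        hinv (4 * k + 2)
  have hden : ∀ k, qPoch (-ζ ^ 2) (ζ ^ 2) k =
      ζ ^ (k * (k + 1)) * qPoch (-p ^ 2) (p ^ 2) k := fun k => by
    induction k with
    | zero => simp [qPoch_zero]
    | succ k ih =>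
      rw [qPoch_succ, qPoch_succ, ih]
      linear_combination -(ζ ^ (k * (k + 1)) * qPoch (-p ^ 2) (p ^ 2) k) * hinv (2 * k + 2)
  have hterm : ∀ k ∈ Finset.range (m + 1), (-1 : ℂ) ^ k * ζ ^ (2 * (k + 1) ^ 2) *
        qPoch (ζ ^ 2) (ζ ^ 4) k / qPoch (-ζ ^ 2) (ζ ^ 2) (2 * k + 1) =
      (p ^ 2) ^ k * qPoch (p ^ 2) (p ^ 4) k /
        qPoch (-p ^ 2) (p ^ 2) (2 * k + 1) := fun k _ => by
    rw [hnum, hden, show (2 * k + 1) * (2 * k + 1 + 1) = 2 * (k + 1) ^ 2 + 2 * k ^ 2 + 2 * k by ring,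
      pow_add, pow_add, ← pow_mul p, eq_inv_of_mul_eq_one_right (hinv (2 * k))]
    have h1 := pow_ne_zero (2 * (k + 1) ^ 2) hζ0
    have h2 := pow_ne_zero (2 * k ^ 2) hζ0
    have h3 := pow_ne_zero (2 * k) hζ0
    have h4 : (-1 : ℂ) ^ k * (-1) ^ k = 1 := by rw [← mul_pow]; simp
    generalize ζ ^ (2 * (k + 1) ^ 2) = a at *
    generalize ζ ^ (2 * k ^ 2) = b at *
    generalize ζ ^ (2 * k) = c at *
    rw [show (-1 : ℂ) ^ k * a * ((-1) ^ k * b * qPoch (p ^ 2) (p ^ 4) k) =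
      ((-1) ^ k * (-1) ^ k) * (a * b) * qPoch (p ^ 2) (p ^ 4) k by ring, h4, one_mul]
    field_simp
  rw [Finset.sum_congr rfl hterm, sum_qPoch_div_eq_sum_theta hp]
  rw [Finset.sum_range_succ', if_pos rfl, mul_add, Finset.mul_sum,
    ← Finset.sum_range_reflect (fun j => _ * (-1) ^ (m + (j + 1)) * _)]
  congr 1
  · refine Finset.sum_congr rfl fun r hr => ?_
    obtain ⟨d, rfl⟩ := Nat.exists_eq_add_of_lt (Finset.mem_range.1 hr)
    rw [show r + d + 1 - 1 - r = d by omega, if_neg d.succ_ne_zero,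
      show r + d + 1 + (d + 1) = r + 2 * (d + 1) by ring, pow_add (-1 : ℂ),
      pow_mul (-1 : ℂ), neg_one_sq, one_pow,
      pow_eq_pow_of_add_mul_eq hpow (x := r + 1) (y := 2 * (d + 1))
        (show (r + d + 1) ^ 2 + 3 * (d + 1) ^ 2 + (2 * (r + d + 1) + 1) * (r + 1) =
          3 * r ^ 2 + 3 * r + 1 + (2 * (r + d + 1) + 1) * (2 * (d + 1)) by ring)]
    ring
  · rw [pow_eq_pow_of_add_mul_eq hpow (x := m + 1) (y := 0)
        (show m ^ 2 + 3 * 0 ^ 2 + (2 * m + 1) * (m + 1) =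
          3 * m ^ 2 + 3 * m + 1 + (2 * m + 1) * 0 by ring)]
    ring

lemma qPoch_add (a q : ℂ) (j k : ℕ) :
    qPoch a q (j + k) = qPoch a q j * qPoch (a * q ^ j) q k := by
  simp only [qPoch, Finset.prod_range_add, mul_assoc, pow_add]

lemma qPoch_mul_prod_reflect {a b q : ℂ} {N : ℕ}
    (h : ∀ i ≤ N, a * q ^ (N - i) * (b * q ^ i) = 1) :
    qPoch a q (N + 1) * ∏ i ∈ Finset.range (N + 1), b * q ^ i =
      (-1) ^ (N + 1) * qPoch b q (N + 1) := by
  have hconst : (-1 : ℂ) ^ (N + 1) = ∏ _i ∈ Finset.range (N + 1), (-1 : ℂ) := by simp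
  rw [qPoch, qPoch, ← Finset.prod_range_reflect, ← Finset.prod_mul_distrib, hconst,
    ← Finset.prod_mul_distrib]
  refine Finset.prod_congr rfl fun i hi => ?_
  have := h i (Nat.lt_succ_iff.1 (Finset.mem_range.1 hi))
  rw [show N + 1 - 1 - i = N - i by omega]
  linear_combination -this

lemma qPoch_sq_mul_qPoch_self_sq {q : ℂ} {m : ℕ} (hq : q ^ (2 * m + 1) = 1) (k d : ℕ)
    (h : k + d = m) :
    qPoch q (q ^ 2) k * qPoch (q ^ 2) (q ^ 2) d =
      (-1) ^ k * q ^ k ^ 2 * qPoch (q ^ 2) (q ^ 2) m := by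
  induction k generalizing d with
  | zero => simp [qPoch_zero, ← h]
  | succ k ih =>
    have h1 := ih (d + 1) (by omega)
    have h2 : q ^ (2 * k + 1) * q ^ (2 * d + 2) = 1 := by
      rw [← pow_add, ← hq]
      congr 1
      omega
    rw [qPoch_self_succ] at h1
    rw [qPoch_succ]
    linear_combination (-q ^ (2 * k + 1)) * h1 -
      qPoch q (q ^ 2) k * qPoch (q ^ 2) (q ^ 2) d * h2

lemma qPoch_self_mul_qPoch_self {q : ℂ} {n : ℕ} (hq : q ^ (n + 1) = 1) (i j : ℕ)
    (h : i + j = n) :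
    qPoch q q i * qPoch q q j = (-1) ^ i * q ^ (i * (i + 1) / 2) * qPoch q q n := by
  induction i generalizing j with
  | zero => simp [qPoch_zero, ← h]
  | succ i ih =>
    have h1 := ih (j + 1) (by omega)
    have h2 : q ^ (i + 1) * q ^ (j + 1) = 1 := by
      rw [← pow_add, ← hq]
      congr 1
      omega
    rw [qPoch_self_succ] at h1
    rw [qPoch_self_succ, show (i + 1) * (i + 1 + 1) = i * (i + 1) + (i + 1) * 2 by ring,
      Nat.add_mul_div_right _ _ two_pos, pow_add q]
    linear_combination (-q ^ (i + 1)) * h1 - qPoch q q i * qPoch q q j * h2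

/-- The inner sums arising when `sum_alternating_inv_qPoch` is inserted in `λ`. -/
noncomputable def lambdaRow (q : ℂ) (m r : ℕ) : ℂ :=
  ∑ j ∈ Finset.range (m - r + 1), q ^ (r + j) * qPoch q (q ^ 2) (r + j) * qPoch q q (r + j) /
    (qPoch q q j * qPoch q q (2 * r + j))

lemma lambdaRow_eq {q : ℂ} {m : ℕ} (hq : IsPrimitiveRoot q (2 * m + 1)) {r : ℕ} (hr : r ≤ m) :
    q ^ r ^ 2 * lambdaRow q m r * qPoch q q (2 * m) =
      (-1) ^ r * qPoch q q r * qPoch (q ^ 2) (q ^ 2) m * qPoch (q ^ (r + 2)) (q ^ 2) (m - r) := by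
  have hs : ∀ i, 0 < i → i ≤ 2 * m → q ^ i ≠ 1 := fun i h0 hi =>
    hq.pow_ne_one_of_pos_of_lt h0.ne' (by omega)
  have hne : ∀ i, i ≤ 2 * m → qPoch q q i ≠ 0 := fun i hi =>
    qPoch_self_ne_zero fun j h0 hj => hs j h0 (by omega)
  obtain ⟨N, rfl⟩ := Nat.exists_eq_add_of_le hr
  rw [lambdaRow, Nat.add_sub_cancel_left, show q ^ (r + 2) = q ^ (r + 1) * q by ring,
    ← sum_qPoch_mul_qPoch_div q _ N fun i h0 hi => hs i h0 (by omega), Finset.mul_sum,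
    Finset.mul_sum, Finset.sum_mul]
  refine Finset.sum_congr rfl fun j hj => ?_
  obtain ⟨d, rfl⟩ := Nat.exists_eq_add_of_le (Nat.lt_succ_iff.1 (Finset.mem_range.1 hj))
  have h1 := qPoch_sq_mul_qPoch_self_sq hq.pow_eq_one (r + j) d (by ring)
  have h2 := qPoch_self_mul_qPoch_self hq.pow_eq_one (2 * r + j) (j + 2 * d) (by ring)
  have hexp : q ^ r ^ 2 * (q ^ (r + j) * q ^ (r + j) ^ 2) =
      q ^ (j * (j + 1) / 2) * q ^ ((2 * r + j) * (2 * r + j + 1) / 2) := by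
    rw [← pow_add, ← pow_add, ← pow_add, show (2 * r + j) * (2 * r + j + 1) =
      j * (j + 1) + (2 * r ^ 2 + 2 * r * j + r) * 2 by ring, Nat.add_mul_div_right _ _ two_pos]
    have := Nat.div_mul_cancel (Nat.even_mul_succ_self j).two_dvd
    congr 1
    generalize j * (j + 1) / 2 = t at *
    linarith
  have h3 := hne j (by omega)
  have h4 := hne (2 * r + j) (by omega)
  have h5 : qPoch (q ^ 2) (q ^ 2) d ≠ 0 := qPoch_self_ne_zero fun i h0 hi => by
    rw [← pow_mul]; exact hs _ (by omega) (by omega)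
  rw [qPoch_add q q r j, ← pow_succ', show j + d - j = d by omega,
    show 2 * (j + d) - j = j + 2 * d by omega]
  rw [show (-1 : ℂ) ^ (r + j) = (-1) ^ r * (-1) ^ j by ring] at h1
  rw [show (-1 : ℂ) ^ (2 * r + j) = (-1) ^ j by rw [pow_add, pow_mul]; simp] at h2
  clear hs hne
  rw [mul_div_assoc', div_mul_eq_mul_div, mul_div_assoc', div_eq_div_iff (by positivity)
    (by positivity)]
  linear_combination (q ^ r ^ 2 * q ^ (r + j) * qPoch q q r * qPoch (q ^ (r + 1)) q j *
      qPoch q q j * qPoch q q (2 * (r + (j + d)))) * h1 -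
    ((-1) ^ r * qPoch q q r * qPoch (q ^ 2) (q ^ 2) (r + (j + d)) * qPoch (q ^ (r + 1)) q j *
      q ^ (j * (j + 1) / 2) * qPoch q q j) * h2 +
    ((-1) ^ r * (-1) ^ j * qPoch q q r * qPoch (q ^ 2) (q ^ 2) (r + (j + d)) *
      qPoch (q ^ (r + 1)) q j * qPoch q q j * qPoch q q (2 * (r + (j + d)))) * hexp

lemma lambdaRow_succ {q : ℂ} {m : ℕ} (hq : IsPrimitiveRoot q (2 * m + 1)) (r d : ℕ)
    (hr : r + d + 1 = m) :
    q ^ (2 * r + 1) * lambdaRow q m (r + 1) =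
      (-1) ^ d * q ^ ((d + 1) * m) * lambdaRow q m r := by
  have hG : qPoch q q (2 * m) ≠ 0 := qPoch_self_ne_zero fun i h0 hi =>
    hq.pow_ne_one_of_pos_of_lt h0.ne' (by omega)
  have h1 := lambdaRow_eq hq (r := r) (by omega)
  have h2 := lambdaRow_eq hq (r := r + 1) (by omega)
  rw [show m - r = d + 1 by omega] at h1
  rw [show m - (r + 1) = d by omega, qPoch_self_succ] at h2
  have hrefl := qPoch_mul_prod_reflect (a := q ^ (r + 2)) (b := q ^ (r + 1)) (q := q ^ 2) (N := d)
    fun i hi => by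
      rw [← pow_mul, ← pow_mul, ← pow_add, ← pow_add, ← pow_add, ← hq.pow_eq_one]
      congr 1
      omega
  have hprod : ∏ i ∈ Finset.range (d + 1), q ^ (r + 1) * (q ^ 2) ^ i = q ^ ((d + 1) * m) := by
    subst hr
    clear * -
    have : ∀ e, ∏ i ∈ Finset.range e, q ^ (r + 1) * (q ^ 2) ^ i = q ^ (e * r + e ^ 2) := fun e => by
      induction e with
      | zero => simp
      | succ e ih =>
        rw [Finset.prod_range_succ, ih]
        ring
    rw [this]
    ring
  have hshift : qPoch (q ^ (r + 1)) (q ^ 2) (d + 1) =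
      (1 - q ^ (r + 1)) * qPoch (q ^ (r + 1 + 2)) (q ^ 2) d := by
    rw [add_comm d, qPoch_add, pow_one, ← pow_add]
    simp [qPoch]
  rw [hprod, hshift] at hrefl
  have hsign : (-1 : ℂ) ^ d * (-1) ^ d = 1 := by rw [← mul_pow]; simp
  refine mul_right_cancel₀ (mul_ne_zero hG (pow_ne_zero (r ^ 2) (hq.ne_zero (by omega)))) ?_
  linear_combination h2 - (-1) ^ d * q ^ ((d + 1) * m) * h1 -
    (-1) ^ r * qPoch q q r * qPoch (q ^ 2) (q ^ 2) m * (-1) ^ d * hrefl +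
    (-1) ^ r * qPoch q q r * qPoch (q ^ 2) (q ^ 2) m * (1 - q ^ (r + 1)) *
      qPoch (q ^ (r + 1 + 2)) (q ^ 2) d * hsign

lemma lambdaRow_mul_pow {q : ℂ} {m : ℕ} (hq : IsPrimitiveRoot q (2 * m + 1)) {r : ℕ}
    (hr : r ≤ m) :
    lambdaRow q m r * q ^ (m ^ 2 * (1 + 3 * r ^ 2)) =
      (-1) ^ (if Even r then m + r / 2 else r / 2 + 1) := by
  induction r with
  | zero =>
    have hM : qPoch (q ^ 2) (q ^ 2) m ≠ 0 := qPoch_self_ne_zero fun i h0 hi => by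
      rw [← pow_mul]
      exact hq.pow_ne_one_of_pos_of_lt (by omega) (by omega)
    have h1 := lambdaRow_eq hq (Nat.zero_le m)
    have h2 := qPoch_sq_mul_qPoch_self_sq hq.pow_eq_one m 0 (by omega)
    simp only [qPoch_zero, qPoch_self_two_mul, mul_one, one_mul, pow_zero, zero_add, Nat.sub_zero,
      ne_eq, OfNat.ofNat_ne_zero, not_false_eq_true, zero_pow] at h1 h2
    simp only [Even.zero, if_true, Nat.zero_div, add_zero, mul_zero, mul_one, ne_eq,
      OfNat.ofNat_ne_zero, not_false_eq_true, zero_pow]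
    have hsign : (-1 : ℂ) ^ m * (-1) ^ m = 1 := by rw [← mul_pow]; simp
    rw [h2] at h1
    refine mul_right_cancel₀ (mul_ne_zero hM hM) ?_
    linear_combination (-1) ^ m * h1 -
      lambdaRow q m 0 * q ^ m ^ 2 * qPoch (q ^ 2) (q ^ 2) m ^ 2 * hsign
  | succ r ih =>
    obtain ⟨d, hd⟩ := Nat.exists_eq_add_of_lt hr
    have h := lambdaRow_succ hq r d hd.symm
    have hq0 := hq.ne_zero (by omega)
    have hsign : (-1 : ℂ) ^ (if Even (r + 1) then m + (r + 1) / 2 else (r + 1) / 2 + 1) =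
        (-1) ^ d * (-1) ^ (if Even r then m + r / 2 else r / 2 + 1) := by
      rw [← pow_add, neg_one_pow_eq_pow_mod_two, neg_one_pow_eq_pow_mod_two (n := d + _)]
      congr 1
      simp only [Nat.even_iff]
      split_ifs <;> omega
    have hexp : q ^ (m ^ 2 * (1 + 3 * (r + 1) ^ 2)) * q ^ ((d + 1) * m) =
        q ^ (2 * r + 1) * q ^ (m ^ 2 * (1 + 3 * r ^ 2)) := by
      rw [← pow_add, ← pow_add]
      refine pow_eq_pow_of_add_mul_eq hq.pow_eq_one (x := 2 * r + 1) (y := (3 * r + 2) * m) ?_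
      subst hd
      ring
    rw [hsign, ← ih (by omega)]
    refine mul_right_cancel₀ (pow_ne_zero (2 * r + 1) hq0) ?_
    linear_combination q ^ (m ^ 2 * (1 + 3 * (r + 1) ^ 2)) * h +
      (-1) ^ d * lambdaRow q m r * hexp

lemma sum_range_triangle_comm (f : ℕ → ℕ → ℂ) (n : ℕ) :
    ∑ k ∈ Finset.range n, ∑ r ∈ Finset.range (k + 1), f r k =
      ∑ r ∈ Finset.range n, ∑ i ∈ Finset.range (n - r), f r (r + i) := by
  induction n with
  | zero => simp
  | succ n ih =>
    have hcol : ∀ r ∈ Finset.range n, ∑ i ∈ Finset.range (n + 1 - r), f r (r + i) =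
        ∑ i ∈ Finset.range (n - r), f r (r + i) + f r n := fun r hr => by
      have := Finset.mem_range.1 hr
      rw [show n + 1 - r = n - r + 1 by omega, Finset.sum_range_succ,
        show r + (n - r) = n by omega]
    rw [Finset.sum_range_succ, Finset.sum_range_succ (fun r => f r n),
      Finset.sum_range_succ (fun r => ∑ i ∈ Finset.range (n + 1 - r), f r (r + i)),
      Finset.sum_congr rfl hcol, Finset.sum_add_distrib, ← ih,
      show n + 1 - n = 1 by omega, Finset.sum_range_one, add_zero]
    ring

lemma qPoch_mul_qPoch_neg (q : ℂ) (k : ℕ) :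
    qPoch q q k * qPoch (-q) q k = qPoch (q ^ 2) (q ^ 2) k := by
  simp only [qPoch, ← Finset.prod_mul_distrib]
  refine Finset.prod_congr rfl fun i _ => ?_
  ring

/-- The `λ` side: a half theta sum in `ζ⁻¹`. -/
lemma lambda_eq_sum_theta {ζ : ℂ} {m : ℕ} (hζ : IsPrimitiveRoot ζ (2 * m + 1)) :
    ∑ k ∈ Finset.range (m + 1),
        (-1 : ℂ) ^ k * ζ ^ k * qPoch ζ (ζ ^ 2) k / qPoch (-ζ) ζ k =
      ∑ s ∈ Finset.range (m + 1), (if s = 0 then 1 else 2) * (-1) ^ s *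
        ((-1) ^ (if Even s then m + s / 2 else s / 2 + 1) * ζ⁻¹ ^ (m ^ 2 * (1 + 3 * s ^ 2))) := by
  have hs : ∀ i, 0 < i → i ≤ 2 * m → ζ ^ i ≠ 1 := fun i h0 hi =>
    hζ.pow_ne_one_of_pos_of_lt h0.ne' (by omega)
  have hterm : ∀ k ∈ Finset.range (m + 1),
      (-1 : ℂ) ^ k * ζ ^ k * qPoch ζ (ζ ^ 2) k / qPoch (-ζ) ζ k =
        ∑ s ∈ Finset.range (k + 1), (if s = 0 then 1 else 2) * (-1) ^ s *
          (ζ ^ k * qPoch ζ (ζ ^ 2) k * qPoch ζ ζ k /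
            (qPoch ζ ζ (k - s) * qPoch ζ ζ (k + s))) := fun k hk => by
    have hk := Finset.mem_range.1 hk
    have h1 : qPoch ζ ζ k ≠ 0 := qPoch_self_ne_zero fun j h0 hj => hs j h0 (by omega)
    have h2 := sum_alternating_inv_qPoch ζ k fun i h0 hi => hs i h0 (by omega)
    have h3 : (qPoch (-ζ) ζ k)⁻¹ = qPoch ζ ζ k * (qPoch (ζ ^ 2) (ζ ^ 2) k)⁻¹ := by
      rw [← qPoch_mul_qPoch_neg, mul_inv, mul_inv_cancel_left₀ h1]
    have hsign : (-1 : ℂ) ^ k * (-1) ^ k = 1 := by rw [← mul_pow]; simp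
    rw [div_eq_mul_inv, h3, ← h2, Finset.mul_sum, Finset.mul_sum]
    refine Finset.sum_congr rfl fun s _ => ?_
    rw [pow_add (-1 : ℂ) k s]
    linear_combination ((if s = 0 then 1 else 2) * (-1) ^ s *
      (ζ ^ k * qPoch ζ (ζ ^ 2) k * qPoch ζ ζ k /
        (qPoch ζ ζ (k - s) * qPoch ζ ζ (k + s)))) * hsign
  rw [Finset.sum_congr rfl hterm, sum_range_triangle_comm fun s k =>
    (if s = 0 then 1 else 2) * (-1) ^ s * (ζ ^ k * qPoch ζ (ζ ^ 2) k * qPoch ζ ζ k /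
      (qPoch ζ ζ (k - s) * qPoch ζ ζ (k + s)))]
  refine Finset.sum_congr rfl fun s hs => ?_
  have hs := Nat.lt_succ_iff.1 (Finset.mem_range.1 hs)
  have h := lambdaRow_mul_pow hζ hs
  have hζ0 := pow_ne_zero (m ^ 2 * (1 + 3 * s ^ 2)) (hζ.ne_zero (by omega))
  rw [← h, inv_pow, mul_inv_cancel_right₀ hζ0, lambdaRow, Finset.mul_sum,
    show m + 1 - s = m - s + 1 by omega]
  refine Finset.sum_congr rfl fun i _ => ?_
  rw [show s + i - s = i by omega, show s + i + s = 2 * s + i by ring]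

lemma sum_theta_reindex {p : ℂ} {m : ℕ} (hp : p ^ (2 * m + 1) = 1) :
    ∑ s ∈ Finset.range (m + 1), (if s = 0 then 1 else 2) * (-1) ^ s *
        ((-1) ^ (if Even s then m + s / 2 else s / 2 + 1) * p ^ (m ^ 2 * (1 + 3 * s ^ 2))) =
      ∑ j ∈ Finset.range (m + 1), (if j = 0 then 1 else 2) * (-1) ^ (m + j) *
        p ^ (m ^ 2 + 3 * j ^ 2) := by
  refine Finset.sum_nbij' (fun s => if Even s then s / 2 else (2 * m + 1 - s) / 2)
    (fun j => if 2 * j ≤ m then 2 * j else 2 * m + 1 - 2 * j) ?_ ?_ ?_ ?_ ?_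
  · intro s hs
    simp only [Finset.mem_range, Nat.even_iff] at *
    split_ifs <;> omega
  · intro j hj
    simp only [Finset.mem_range] at *
    split_ifs <;> omega
  · intro s hs
    simp only [Finset.mem_range, Nat.even_iff] at *
    split_ifs <;> omega
  · intro j hj
    simp only [Finset.mem_range, Nat.even_iff] at *
    split_ifs <;> omega
  · intro s hs
    have hs := Nat.lt_succ_iff.1 (Finset.mem_range.1 hs)
    rcases Nat.even_or_odd' s with ⟨t, rfl | rfl⟩
    · rw [if_pos (even_two_mul t), if_pos (even_two_mul t), Nat.mul_div_cancel_left t two_pos,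
        pow_mul (-1 : ℂ), neg_one_sq, one_pow, mul_one,
        pow_eq_pow_of_add_mul_eq hp (x := 3 * t ^ 2) (y := 6 * m * t ^ 2)
          (show m ^ 2 * (1 + 3 * (2 * t) ^ 2) + (2 * m + 1) * (3 * t ^ 2) =
            m ^ 2 + 3 * t ^ 2 + (2 * m + 1) * (6 * m * t ^ 2) by ring), ← mul_assoc]
      simp
    · obtain ⟨j, rfl⟩ : ∃ j, m = t + j := Nat.exists_eq_add_of_le (by omega)
      have hodd : ¬ Even (2 * t + 1) := by simp
      have hsign : (-1 : ℂ) ^ (2 * t + 1) * (-1) ^ (t + 1) = (-1) ^ (t + j + j) := by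
        rw [← pow_add, neg_one_pow_eq_pow_mod_two, neg_one_pow_eq_pow_mod_two (n := t + j + j)]
        congr 1
        omega
      rw [if_neg hodd, if_neg hodd, show (2 * t + 1) / 2 = t by omega,
        show (2 * (t + j) + 1 - (2 * t + 1)) / 2 = j by omega, if_neg (by omega),
        if_neg (show j ≠ 0 by omega), ← hsign,
        pow_eq_pow_of_add_mul_eq hp (x := 12 * (t + j) ^ 2 * j + 3 * j ^ 2)
          (y := 3 * (t + j) ^ 2 * (2 * (t + j) + 1) + 6 * (t + j) * j ^ 2)
          (show (t + j) ^ 2 * (1 + 3 * (2 * t + 1) ^ 2) +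
              (2 * (t + j) + 1) * (12 * (t + j) ^ 2 * j + 3 * j ^ 2) =
            (t + j) ^ 2 + 3 * j ^ 2 + (2 * (t + j) + 1) *
              (3 * (t + j) ^ 2 * (2 * (t + j) + 1) + 6 * (t + j) * j ^ 2) by ring)]
      ring

/-- λ(ζ) = 2 ζ⁻¹ ψ(ζ²) at odd primitive roots of unity. -/
theorem lambda_eq_two_inv_psi_sq_at_primitive_root
    (n : ℕ) (hn : 0 < n) (hodd : Odd n) (ζ : ℂ) (hζ : IsPrimitiveRoot ζ n) :
    ∑ k ∈ Finset.range ((n - 1) / 2 + 1),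
        (-1 : ℂ) ^ k * ζ ^ k * qPoch ζ (ζ ^ 2) k / qPoch (-ζ) ζ k =
      2 * ζ⁻¹ * ∑ k ∈ Finset.range ((n - 1) / 2 + 1),
        (-1 : ℂ) ^ k * ζ ^ (2 * (k + 1) ^ 2) * qPoch (ζ ^ 2) (ζ ^ 4) k /
          qPoch (-ζ ^ 2) (ζ ^ 2) (2 * k + 1) := by
  obtain ⟨m, rfl⟩ := hodd
  rw [show (2 * m + 1 - 1) / 2 = m by omega, two_inv_mul_psi_eq hζ, lambda_eq_sum_theta hζ,
    sum_theta_reindex hζ.inv.pow_eq_one]
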